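/- The union over all g ∈ G of the W_6-orbits W_6·g has exactly 1279 elements. -/

import Mathlib

/-- The intersection form on the divisor class lattice `L = Fin 7 → ℤ`:
`⟨x, y⟩ = x₀y₀ − x₁y₁ − ⋯ − x₆y₆`. -/
def form (x y : Fin 7 → ℤ) : ℤ :=
  x 0 * y 0 - x 1 * y 1 - x 2 * y 2 - x 3 * y 3 - x 4 * y 4 - x 5 * y 5 - x 6 * y 6

/-- The standard basis vectors `e 0, …, e 6` of `L`. -/
def e (i : Fin 7) : Fin 7 → ℤ := fun j => if j = i then 1 else 0

/-- The anticanonical class `κ = 3e₀ − e₁ − ⋯ − e₆`. -/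
def kappa : Fin 7 → ℤ := (3 : ℤ) • e 0 - e 1 - e 2 - e 3 - e 4 - e 5 - e 6

/-- The simple roots `r₀ = e₀ − e₁ − e₂ − e₃` and `rᵢ = eᵢ − e_{i+1}` for `1 ≤ i ≤ 5`. -/
def r : Fin 6 → (Fin 7 → ℤ) :=
  ![e 0 - e 1 - e 2 - e 3, e 1 - e 2, e 2 - e 3, e 3 - e 4, e 4 - e 5, e 5 - e 6]

lemma form_add_left (x y v : Fin 7 → ℤ) : form (x + y) v = form x v + form y v := by
  simp only [form, Pi.add_apply]; ring

lemma form_smul_left (c : ℤ) (x v : Fin 7 → ℤ) : form (c • x) v = c * form x v := by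
  simp only [form, Pi.smul_apply, smul_eq_mul]; ring

/-- The reflection `x ↦ x + ⟨x, v⟩·v` as a ℤ-linear map. -/
def reflMap (v : Fin 7 → ℤ) : (Fin 7 → ℤ) →ₗ[ℤ] (Fin 7 → ℤ) where
  toFun x := x + form x v • v
  map_add' x y := by
    funext j
    simp only [form, Pi.add_apply, Pi.smul_apply, smul_eq_mul]
    ring
  map_smul' c x := by
    funext j
    simp only [form, Pi.add_apply, Pi.smul_apply, smul_eq_mul, RingHom.id_apply]
    ring

lemma reflMap_invol (v : Fin 7 → ℤ) (hv : form v v = -2) (x : Fin 7 → ℤ) :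
    reflMap v (reflMap v x) = x := by
  show (x + form x v • v) + form (x + form x v • v) v • v = x
  rw [form_add_left, form_smul_left, hv]
  module

/-- The reflection `sᵢ(x) = x + ⟨x, rᵢ⟩·rᵢ` through the simple root `rᵢ`,
as a ℤ-linear automorphism of `L`. -/
def s (i : Fin 6) : (Fin 7 → ℤ) ≃ₗ[ℤ] (Fin 7 → ℤ) :=
  LinearEquiv.ofLinear (reflMap (r i)) (reflMap (r i))
    (LinearMap.ext fun x => reflMap_invol (r i) (by fin_cases i <;> decide) x)
    (LinearMap.ext fun x => reflMap_invol (r i) (by fin_cases i <;> decide) x)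

/-- The Weyl group `W₆`: the subgroup of the group of ℤ-linear automorphisms of `L`
generated by the reflections `s₀, …, s₅`. -/
def W6 : Subgroup ((Fin 7 → ℤ) ≃ₗ[ℤ] (Fin 7 → ℤ)) :=
  Subgroup.closure (Set.range s)

/-- The set `G` of seven classes generating the fundamental domain `A`. -/
def Gset : Set (Fin 7 → ℤ) :=
  {e 0, e 0 - e 1, (2 : ℤ) • e 0 - e 1 - e 2, (3 : ℤ) • e 0 - e 1 - e 2 - e 3,
   (3 : ℤ) • e 0 - e 1 - e 2 - e 3 - e 4, (3 : ℤ) • e 0 - e 1 - e 2 - e 3 - e 4 - e 5,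
   (3 : ℤ) • e 0 - e 1 - e 2 - e 3 - e 4 - e 5 - e 6}

/-- Seven natural coordinates. -/
structure V7 where
  (a b c d p q u : ℕ)

namespace V7

/-- The corresponding lattice vector. -/
def vec (v : V7) : Fin 7 → ℤ := ![(v.a : ℤ), -(v.b : ℤ), -(v.c : ℤ), -(v.d : ℤ), -(v.p : ℤ), -(v.q : ℤ), -(v.u : ℤ)]

/-- A numerical key used for comparison. -/
def key (v : V7) : ℕ :=
  Nat.add v.a (Nat.mul 32 (Nat.add v.b (Nat.mul 32
  (Nat.add v.c (Nat.mul 32 (Nat.add v.d (Nat.mul 32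
  (Nat.add v.p (Nat.mul 32 (Nat.add v.q (Nat.mul 32
  v.u)))))))))))

/-- Boolean equality of coordinates. -/
def eqb (v w : V7) : Bool :=
  Nat.beq v.a w.a && (Nat.beq v.b w.b && (Nat.beq v.c w.c && (Nat.beq v.d w.d &&
  (Nat.beq v.p w.p && (Nat.beq v.q w.q && Nat.beq v.u w.u)))))

theorem eq_of_eqb {v w : V7} (h : eqb v w = true) : v = w := by
  cases v; cases w
  simpa [eqb, Nat.beq_eq] using h

/-- The reflections. -/
def refl0 : V7 → V7
  | ⟨a, b, c, d, p, q, u⟩ =>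
    ⟨Nat.sub (Nat.mul 2 a) (Nat.add b (Nat.add c d)), Nat.sub a (Nat.add c d),
      Nat.sub a (Nat.add b d), Nat.sub a (Nat.add b c), p, q, u⟩

/-- No truncation happens in `refl0`. -/
def ok : V7 → Bool
  | ⟨a, b, c, d, _, _, _⟩ => Nat.ble (Nat.add b (Nat.add c d)) (Nat.mul 2 a) &&
    (Nat.ble (Nat.add c d) a && (Nat.ble (Nat.add b d) a && Nat.ble (Nat.add b c) a))

def refl1 : V7 → V7 | ⟨a, b, c, d, p, q, u⟩ => ⟨a, c, b, d, p, q, u⟩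
def refl2 : V7 → V7 | ⟨a, b, c, d, p, q, u⟩ => ⟨a, b, d, c, p, q, u⟩
def refl3 : V7 → V7 | ⟨a, b, c, d, p, q, u⟩ => ⟨a, b, c, p, d, q, u⟩
def refl4 : V7 → V7 | ⟨a, b, c, d, p, q, u⟩ => ⟨a, b, c, d, q, p, u⟩
def refl5 : V7 → V7 | ⟨a, b, c, d, p, q, u⟩ => ⟨a, b, c, d, p, u, q⟩

/-- All six reflections. -/
def refls : List (V7 → V7) := [refl0, refl1, refl2, refl3, refl4, refl5]

/-- Index of the first simple root pairing negatively (6 if none). -/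
def desc (v : V7) : ℕ :=
  bif Nat.ble (Nat.succ v.a) (Nat.add v.b (Nat.add v.c v.d)) then 0 else
  bif Nat.ble (Nat.succ v.b) v.c then 1 else
  bif Nat.ble (Nat.succ v.c) v.d then 2 else
  bif Nat.ble (Nat.succ v.d) v.p then 3 else
  bif Nat.ble (Nat.succ v.p) v.q then 4 else
  bif Nat.ble (Nat.succ v.q) v.u then 5 else 6

/-- Binary search trees. -/
inductive T where
  | leaf : T
  | node : T → V7 → T → T

namespace T

noncomputable def ins (x : V7) (t : T) : T :=
  T.rec (motive := fun _ => T) (node leaf x leaf)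
    (fun l y r il ir => bif Nat.ble x.key y.key then node il y r else node l y ir) t

theorem ins_leaf (x : V7) : ins x leaf = node leaf x leaf := rfl

theorem ins_node (x y : V7) (l r : T) : ins x (node l y r) =
    bif Nat.ble x.key y.key then node (ins x l) y r else node l y (ins x r) := rfl

noncomputable def mem (x : V7) (t : T) : Bool :=
  T.rec (motive := fun _ => Bool) false
    (fun _ y _ ml mr => bif Nat.ble x.key y.key then
      (bif Nat.beq x.key y.key then eqb x y else ml) else mr) t

theorem mem_leaf (x : V7) : mem x leaf = false := rfl

theorem mem_node (x y : V7) (l r : T) : mem x (node l y r) =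
    bif Nat.ble x.key y.key then
      (bif Nat.beq x.key y.key then eqb x y else mem x l) else mem x r := rfl

def toL : T → List V7 → List V7
  | leaf, acc => acc
  | node l y r, acc => toL l (y :: toL r acc)

/-- Membership. -/
def In (x : V7) : T → Prop
  | leaf => False
  | node l y r => In x l ∨ x = y ∨ In x r

theorem mem_toL (x : V7) (t : T) : ∀ acc, x ∈ toL t acc ↔ In x t ∨ x ∈ acc := by
  induction t with
  | leaf => simp [toL, In]
  | node l y r ihl ihr =>
    intro acc
    simp only [toL, In, ihl, ihr, List.mem_cons]
    tauto

theorem in_of_mem (x : V7) (t : T) (h : mem x t = true) : In x t := by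
  induction t with
  | leaf => simp [mem_leaf] at h
  | node l y r ihl ihr =>
    rw [mem_node] at h
    cases h1 : Nat.beq x.key y.key <;> cases h2 : Nat.ble x.key y.key <;>
      simp only [h1, h2, cond_true, cond_false] at h
    · exact Or.inr (Or.inr (ihr h))
    · exact Or.inl (ihl h)
    · exact Or.inr (Or.inr (ihr h))
    · exact Or.inr (Or.inl (eq_of_eqb h))

theorem in_ins (x z : V7) (t : T) (h : In z (ins x t)) : z = x ∨ In z t := by
  induction t with
  | leaf => simpa [ins_leaf, In] using h
  | node l y r ihl ihr =>
    rw [ins_node] at h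
    cases h2 : Nat.ble x.key y.key <;> simp only [h2, cond_true, cond_false, In] at h ⊢
    · rcases h with h | h | h
      · exact Or.inr (Or.inl h)
      · exact Or.inr (Or.inr (Or.inl h))
      · exact (ihr h).imp id (fun h => Or.inr (Or.inr h))
    · rcases h with h | h | h
      · exact (ihl h).imp id Or.inl
      · exact Or.inr (Or.inr (Or.inl h))
      · exact Or.inr (Or.inr (Or.inr h))

end T

/-- Canonical child of `v` along reflection number `i`. -/
def child (v : V7) (i : ℕ) (f : V7 → V7) : List V7 :=
  bif Nat.beq (desc (f v)) i && !(eqb (f v) v) then [f v] else []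

def children (v : V7) : List V7 :=
  (bif ok v then child v 0 refl0 else []) ++ (child v 1 refl1 ++ (child v 2 refl2 ++
    (child v 3 refl3 ++ (child v 4 refl4 ++ child v 5 refl5))))

/-- Add the whole orbit tree below `v`. -/
noncomputable def gen : ℕ → V7 → T → T
  | 0, _, t => t
  | n + 1, v, t => (children v).foldr (fun w t => gen n w t) (T.ins v t)

def gens : List V7 :=
  [⟨1, 0, 0, 0, 0, 0, 0⟩, ⟨1, 1, 0, 0, 0, 0, 0⟩, ⟨2, 1, 1, 0, 0, 0, 0⟩,
   ⟨3, 1, 1, 1, 0, 0, 0⟩, ⟨3, 1, 1, 1, 1, 0, 0⟩, ⟨3, 1, 1, 1, 1, 1, 0⟩,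
   ⟨3, 1, 1, 1, 1, 1, 1⟩]

/-- The tree of all elements. -/
noncomputable def tree : T := gens.foldr (fun w t => gen 40 w t) T.leaf

def sorted : List V7 → Bool
  | [] => true
  | x :: l => (match l with
    | [] => true
    | y :: _ => Nat.ble (Nat.succ x.key) y.key) && sorted l

noncomputable def closedB (t : T) (l : List V7) : Bool :=
  l.all fun x => ok x && refls.all fun f =>
    bif eqb (f x) x then true else T.mem (f x) t

noncomputable def check (t : T) : Bool :=
  Nat.beq (T.toL t []).length 1279 && (sorted (T.toL t []) &&
    (closedB t (T.toL t []) && gens.all fun g => T.mem g t))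

set_option maxRecDepth 100000 in
theorem check_tree : check tree = true := by decide +kernel

end V7

/-- The union of orbits. -/
def InOrb (x : Fin 7 → ℤ) : Prop := ∃ g ∈ Gset, ∃ w ∈ W6, w g = x

theorem s_apply (i : Fin 6) (x : Fin 7 → ℤ) : s i x = x + form x (r i) • r i := rfl

theorem s_s (i : Fin 6) (x : Fin 7 → ℤ) : s i (s i x) = x :=
  reflMap_invol (r i) (by fin_cases i <;> decide) x

theorem InOrb.s {x : Fin 7 → ℤ} (h : InOrb x) (i : Fin 6) : InOrb (s i x) := by
  obtain ⟨g, hg, w, hw, rfl⟩ := h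
  exact ⟨g, hg, _root_.s i * w,
    W6.mul_mem (Subgroup.subset_closure (Set.mem_range_self i)) hw, rfl⟩

namespace V7

theorem vec0 (v : V7) (hv : ok v = true) : (refl0 v).vec = s 0 v.vec := by
  obtain ⟨a, b, c, d, p, q, u⟩ := v
  simp only [ok, Bool.and_eq_true, Nat.ble_eq, Nat.add_eq, Nat.mul_eq] at hv
  funext j; rw [s_apply]
  fin_cases j <;> simp [vec, refl0, form, r, e] <;> omega
theorem vec1 (v : V7) : (refl1 v).vec = s 1 v.vec := by
  funext j; rw [s_apply]
  fin_cases j <;> simp [vec, refl1, form, r, e] <;> ring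
theorem vec2 (v : V7) : (refl2 v).vec = s 2 v.vec := by
  funext j; rw [s_apply]
  fin_cases j <;> simp [vec, refl2, form, r, e] <;> ring
theorem vec3 (v : V7) : (refl3 v).vec = s 3 v.vec := by
  funext j; rw [s_apply]
  fin_cases j <;> simp [vec, refl3, form, r, e] <;> ring
theorem vec4 (v : V7) : (refl4 v).vec = s 4 v.vec := by
  funext j; rw [s_apply]
  fin_cases j <;> simp [vec, refl4, form, r, e] <;> ring
theorem vec5 (v : V7) : (refl5 v).vec = s 5 v.vec := by
  funext j; rw [s_apply]
  fin_cases j <;> simp [vec, refl5, form, r, e] <;> ring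

theorem vec_inj {v w : V7} (h : v.vec = w.vec) : v = w := by
  cases v; cases w
  have h0 := congrFun h 0
  have h1 := congrFun h 1
  have h2 := congrFun h 2
  have h3 := congrFun h 3
  have h4 := congrFun h 4
  have h5 := congrFun h 5
  have h6 := congrFun h 6
  simp [vec] at h0 h1 h2 h3 h4 h5 h6
  simp [*]

theorem child_eq {v w : V7} {i : ℕ} {f : V7 → V7} (h : w ∈ child v i f) : w = f v := by
  unfold child at h
  cases hc : (Nat.beq (desc (f v)) i && !(eqb (f v) v)) <;> rw [hc] at h <;> simpa using h

theorem children_orb {v w : V7} (hv : InOrb v.vec) (h : w ∈ children v) : InOrb w.vec := by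
  simp only [children, List.mem_append] at h
  rcases h with h | h | h | h | h | h
  · cases ho : ok v <;> rw [ho] at h
    · simp at h
    · rw [cond_true] at h
      rw [child_eq h, vec0 v ho]; exact hv.s _
  · rw [child_eq h, vec1]; exact hv.s _
  · rw [child_eq h, vec2]; exact hv.s _
  · rw [child_eq h, vec3]; exact hv.s _
  · rw [child_eq h, vec4]; exact hv.s _
  · rw [child_eq h, vec5]; exact hv.s _

theorem foldr_orb (F : V7 → T → T)
    (hF : ∀ v t, InOrb v.vec → (∀ z, T.In z t → InOrb z.vec) →
      ∀ z, T.In z (F v t) → InOrb z.vec)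
    (l : List V7) (hl : ∀ v ∈ l, InOrb v.vec) (t : T) (ht : ∀ z, T.In z t → InOrb z.vec) :
    ∀ z, T.In z (l.foldr F t) → InOrb z.vec := by
  induction l with
  | nil => exact ht
  | cons a l ih =>
    exact hF a _ (hl a (by simp)) (ih fun v hv => hl v (by simp [hv]))

theorem gen_orb (n : ℕ) : ∀ v t, InOrb v.vec → (∀ z, T.In z t → InOrb z.vec) →
      ∀ z, T.In z (gen n v t) → InOrb z.vec := by
  induction n with
  | zero => intro v t _ ht; exact ht
  | succ n ih =>
    intro v t hv ht
    refine foldr_orb _ ih _ (fun w hw => children_orb hv hw) _ ?_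
    intro z hz
    rcases T.in_ins _ _ _ hz with rfl | h
    · exact hv
    · exact ht z h

theorem gens_vec : Gset = {x | ∃ v ∈ gens, v.vec = x} := by
  ext x
  have h0 : vec ⟨1, 0, 0, 0, 0, 0, 0⟩ = e 0 := by decide
  have h1 : vec ⟨1, 1, 0, 0, 0, 0, 0⟩ = e 0 - e 1 := by decide
  have h2 : vec ⟨2, 1, 1, 0, 0, 0, 0⟩ = (2 : ℤ) • e 0 - e 1 - e 2 := by decide
  have h3 : vec ⟨3, 1, 1, 1, 0, 0, 0⟩ = (3 : ℤ) • e 0 - e 1 - e 2 - e 3 := by decide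
  have h4 : vec ⟨3, 1, 1, 1, 1, 0, 0⟩ = (3 : ℤ) • e 0 - e 1 - e 2 - e 3 - e 4 := by decide
  have h5 : vec ⟨3, 1, 1, 1, 1, 1, 0⟩ =
    (3 : ℤ) • e 0 - e 1 - e 2 - e 3 - e 4 - e 5 := by decide
  have h6 : vec ⟨3, 1, 1, 1, 1, 1, 1⟩ =
    (3 : ℤ) • e 0 - e 1 - e 2 - e 3 - e 4 - e 5 - e 6 := by decide
  simp only [Gset, gens, Set.mem_setOf_eq, List.mem_cons, List.not_mem_nil, or_false,
    exists_eq_or_imp, exists_eq_left, h0, h1, h2, h3, h4, h5, h6, Set.mem_insert_iff,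
    Set.mem_singleton_iff, eq_comm (a := x)]

theorem tree_orb : ∀ z, T.In z tree → InOrb z.vec := by
  refine foldr_orb _ (gen_orb 40) gens ?_ T.leaf (fun z hz => hz.elim)
  intro v hv
  exact ⟨v.vec, by rw [gens_vec]; exact ⟨v, hv, rfl⟩, 1, W6.one_mem, rfl⟩

theorem sorted_chain : ∀ l : List V7, sorted l = true → (l.map key).IsChain (· < ·)
  | [], _ => by simp
  | [x], _ => by simp
  | x :: y :: l, h => by
    simp only [sorted, Bool.and_eq_true] at h
    have h2 := sorted_chain (y :: l) (by simpa only [sorted, Bool.and_eq_true] using h.2)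
    have h1 : x.key < y.key := Nat.le_of_ble_eq_true h.1
    simp only [List.map_cons, List.isChain_cons_cons] at h2 ⊢
    exact ⟨h1, h2⟩

theorem final (t : T) (ht : check t = true) (horb : ∀ z, T.In z t → InOrb z.vec) :
    Set.ncard {x : Fin 7 → ℤ | InOrb x} = 1279 := by
  simp only [check, Bool.and_eq_true] at ht
  obtain ⟨hlen, hsort, hcl, hg⟩ := ht
  have hlen := Nat.eq_of_beq_eq_true hlen
  have hmem : ∀ x, x ∈ T.toL t [] ↔ T.In x t := fun x => by simp [T.mem_toL]
  have hnd : (T.toL t []).Nodup := by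
    have h := (List.isChain_iff_pairwise.mp (sorted_chain _ hsort))
    exact List.Nodup.of_map key (h.imp fun h => ne_of_lt h)
  have hclosed : ∀ x, T.In x t → ok x = true ∧ ∀ f ∈ refls, T.In (f x) t := by
    intro x hx
    have h := List.all_eq_true.mp hcl x ((hmem x).2 hx)
    rw [Bool.and_eq_true] at h
    refine ⟨h.1, fun f hf => ?_⟩
    have h3 := List.all_eq_true.mp h.2 f hf
    cases h4 : eqb (f x) x
    · rw [h4, cond_false] at h3
      exact T.in_of_mem _ _ h3
    · rw [eq_of_eqb h4]
      exact hx
  have hs : ∀ (i : Fin 6) (x : Fin 7 → ℤ), (∃ v, T.In v t ∧ v.vec = x) →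
      ∃ v, T.In v t ∧ v.vec = s i x := by
    rintro i x ⟨v, hv, rfl⟩
    obtain ⟨ho, h⟩ := hclosed v hv
    fin_cases i
    · exact ⟨_, h refl0 (by simp [refls]), vec0 v ho⟩
    · exact ⟨_, h refl1 (by simp [refls]), vec1 v⟩
    · exact ⟨_, h refl2 (by simp [refls]), vec2 v⟩
    · exact ⟨_, h refl3 (by simp [refls]), vec3 v⟩
    · exact ⟨_, h refl4 (by simp [refls]), vec4 v⟩
    · exact ⟨_, h refl5 (by simp [refls]), vec5 v⟩
  have hw : ∀ w ∈ W6, ∀ x : Fin 7 → ℤ, (∃ v, T.In v t ∧ v.vec = x) ↔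
      ∃ v, T.In v t ∧ v.vec = w x := by
    intro w hw
    induction hw using Subgroup.closure_induction with
    | mem w hw =>
      obtain ⟨i, rfl⟩ := hw
      intro x
      refine ⟨hs i x, fun h => ?_⟩
      have h2 := hs i _ h
      rwa [s_s] at h2
    | one => intro x; exact Iff.rfl
    | mul a b _ _ iha ihb => intro x; exact (ihb x).trans (iha (b x))
    | inv a _ iha =>
      intro x
      have h := iha (a⁻¹ x)
      have h2 : a (a⁻¹ x) = x := a.apply_symm_apply x
      rw [h2] at h
      exact h.symm
  have hset : {x : Fin 7 → ℤ | InOrb x} = vec '' {v | v ∈ T.toL t []} := by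
    ext x
    constructor
    · rintro ⟨g, hgG, w, hwW, rfl⟩
      rw [gens_vec] at hgG
      obtain ⟨v, hv, rfl⟩ := hgG
      have h1 := T.in_of_mem _ _ (List.all_eq_true.mp hg v hv)
      obtain ⟨u, hu, hu2⟩ := (hw w hwW v.vec).1 ⟨v, h1, rfl⟩
      exact ⟨u, (hmem u).2 hu, hu2⟩
    · rintro ⟨v, hv, rfl⟩
      exact horb v ((hmem v).1 hv)
  rw [hset, Set.ncard_image_of_injective _ (fun _ _ h => vec_inj h)]
  classical
  have : {v | v ∈ T.toL t []} = ((T.toL t []).toFinset : Set V7) := by ext; simp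
  rw [this, Set.ncard_coe_finset, List.toFinset_card_of_nodup hnd, hlen]

end V7

/-- The union of the `W₆`-orbits of the seven classes in `G` has exactly
1279 elements. -/
theorem statement_7 :
    Set.ncard {x : Fin 7 → ℤ | ∃ g ∈ Gset, ∃ w ∈ W6, w g = x} = 1279 := by
  exact V7.final V7.tree V7.check_tree V7.tree_orb
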